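/- All non-initial rules of S(O) are hp-invertible: for every instance of one of the rules (s≐), (⊔), (⊓), (∃r), (∀r), (≤n r), (≥n r) of S(O), if the conclusion of the instance has a proof of height h in S(O), then each premise of the instance has a proof of height at most h in S(O). -/

import Mathlib

set_option maxHeartbeats 1000000

namespace RIQ

/-- Roles: role names and inverse roles. -/
inductive Role : Type
  | name : ℕ → Role
  | inv  : ℕ → Role
deriving DecidableEq

/-- The inverse of a role. -/
def Role.invert : Role → Role
  | .name r => .inv r
  | .inv r  => .name r

/-- RIQ concepts in negation normal form. -/
inductive Concept : Type
  | atom : ℕ → Concept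
  | nneg : ℕ → Concept
  | inter : Concept → Concept → Concept
  | union : Concept → Concept → Concept
  | ex : Role → Concept → Concept
  | all : Role → Concept → Concept
  | atMost : ℕ → Role → Concept → Concept
  | atLeast : ℕ → Role → Concept → Concept
deriving DecidableEq

/-- ⊤ := A₀ ⊔ ¬A₀ for the fixed concept name A₀ = 0. -/
def topC : Concept := .union (.atom 0) (.nneg 0)

/-- ⊥ := A₀ ⊓ ¬A₀ for the fixed concept name A₀ = 0. -/
def botC : Concept := .inter (.atom 0) (.nneg 0)

/-- NNF-negation. -/
def nnfNeg : Concept → Concept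
  | .atom A => .nneg A
  | .nneg A => .atom A
  | .inter C D => .union (nnfNeg C) (nnfNeg D)
  | .union C D => .inter (nnfNeg C) (nnfNeg D)
  | .ex r C => .all r (nnfNeg C)
  | .all r C => .ex r (nnfNeg C)
  | .atMost n r C => .atLeast (n+1) r C
  | .atLeast 0 _ _ => botC
  | .atLeast (n+1) r C => .atMost n r C

/-- Literals: concept names and their negations. -/
def IsLiteral : Concept → Prop
  | .atom _ => True
  | .nneg _ => True
  | _ => False

/-- A complex role inclusion axiom r₁ ∘ ⋯ ∘ rₙ ⊑ s. -/
structure RIA where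
  lhs : List Role
  rhs : Role
deriving DecidableEq

/-- An ontology: a finite set of RIAs (RBox) together with a finite set of
GCIs (TBox), each GCI ⊤ ⊑ C being recorded by its right-hand concept C. -/
structure Ontology where
  rias : Finset RIA
  gcis : Finset Concept

/-- Union of two ontologies. -/
def Ontology.union (O₁ O₂ : Ontology) : Ontology := ⟨O₁.rias ∪ O₂.rias, O₁.gcis ∪ O₂.gcis⟩

/-- Concept names occurring in a concept. -/
def cnames : Concept → Finset ℕ
  | .atom A => {A}
  | .nneg A => {A}
  | .inter C D => cnames C ∪ cnames D
  | .union C D => cnames C ∪ cnames D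
  | .ex _ C => cnames C
  | .all _ C => cnames C
  | .atMost _ _ C => cnames C
  | .atLeast _ _ C => cnames C

/-- Concept names occurring in an ontology. -/
def Ontology.cnames (O : Ontology) : Finset ℕ := O.gcis.sup RIQ.cnames

/-- An interpretation over the domain δ. -/
structure Interp (δ : Type) where
  cI : ℕ → Set δ
  rI : ℕ → Set (δ × δ)

/-- Interpretation of roles. -/
def Interp.roleI {δ : Type} (I : Interp δ) : Role → Set (δ × δ)
  | .name r => I.rI r
  | .inv r  => {p | (p.2, p.1) ∈ I.rI r}

/-- Relational composition of a list of roles (empty composition is the identity). -/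
def Interp.listComp {δ : Type} (I : Interp δ) : List Role → Set (δ × δ)
  | [] => {p | p.1 = p.2}
  | r :: rs => {p | ∃ b, (p.1, b) ∈ I.roleI r ∧ (b, p.2) ∈ I.listComp rs}

/-- Interpretation of concepts. -/
def Interp.cInterp {δ : Type} (I : Interp δ) : Concept → Set δ
  | .atom A => I.cI A
  | .nneg A => (I.cI A)ᶜ
  | .inter C D => I.cInterp C ∩ I.cInterp D
  | .union C D => I.cInterp C ∪ I.cInterp D
  | .ex r C => {a | ∃ b, (a, b) ∈ I.roleI r ∧ b ∈ I.cInterp C}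
  | .all r C => {a | ∀ b, (a, b) ∈ I.roleI r → b ∈ I.cInterp C}
  | .atMost n r C => {a | {b | (a, b) ∈ I.roleI r ∧ b ∈ I.cInterp C}.encard ≤ (n : ℕ∞)}
  | .atLeast n r C => {a | (n : ℕ∞) ≤ {b | (a, b) ∈ I.roleI r ∧ b ∈ I.cInterp C}.encard}

/-- I ⊨ O. -/
def Interp.models {δ : Type} (I : Interp δ) (O : Ontology) : Prop :=
  (∀ C ∈ O.gcis, I.cInterp topC ⊆ I.cInterp C) ∧
  (∀ ria ∈ O.rias, I.listComp ria.lhs ⊆ I.roleI ria.rhs)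

/-- O ⊨ C ⊑ D. -/
def entails (O : Ontology) (C D : Concept) : Prop :=
  ∀ (δ : Type) [Nonempty δ] (I : Interp δ), I.models O → I.cInterp C ⊆ I.cInterp D

/-- Production rules of the R-system G(O). -/
def ProdRule (O : Ontology) (s : Role) (T : List Role) : Prop :=
  ∃ ria ∈ O.rias, (s = ria.rhs ∧ T = ria.lhs) ∨
    (s = ria.rhs.invert ∧ T = (ria.lhs.map Role.invert).reverse)

/-- One-step derivation in the R-system G(O). -/
def OneStep (O : Ontology) (S R : List Role) : Prop :=
  ∃ S' s T R', ProdRule O s T ∧ S = S' ++ s :: R' ∧ R = S' ++ T ++ R'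

/-- The language L_{G(O)}(r). -/
def lang (O : Ontology) (r : Role) : Set (List Role) :=
  {S | Relation.ReflTransGen (OneStep O) [r] S}

/-- Structural atoms: role atoms, equality atoms and inequality atoms
(labels are natural numbers). -/
inductive SAtom : Type
  | rel : Role → ℕ → ℕ → SAtom
  | eq : ℕ → ℕ → SAtom
  | neq : ℕ → ℕ → SAtom
deriving DecidableEq

/-- Labels occurring in a structural atom. -/
def SAtom.labels : SAtom → Finset ℕ
  | .rel _ x y => {x, y}
  | .eq x y => {x, y}
  | .neq x y => {x, y}

/-- Labeled concepts. -/
abbrev LC := ℕ × Concept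

/-- Labels occurring in a finite set of structural atoms. -/
def labSetF (Γ : Finset SAtom) : Finset ℕ := Γ.biUnion SAtom.labels

/-- Labels occurring in a multiset of labeled concepts. -/
def Δlabels (Δ : Multiset LC) : Finset ℕ := (Δ.map Prod.fst).toFinset

/-- One step of the equality chain x ≈ y (an equality atom in either orientation). -/
def eqStep (Γ : Set SAtom) (x y : ℕ) : Prop := SAtom.eq x y ∈ Γ ∨ SAtom.eq y x ∈ Γ

/-- x ∼_Γ y : x and y are linked by a finite chain of equality atoms of Γ. -/
def eqRel (Γ : Set SAtom) : ℕ → ℕ → Prop := Relation.ReflTransGen (eqStep Γ)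

/-- Edge of the propagation graph PG(Γ) between the classes of x and y, labeled r. -/
def pgEdge (Γ : Set SAtom) (x : ℕ) (r : Role) (y : ℕ) : Prop :=
  (∃ z w, eqRel Γ x z ∧ eqRel Γ y w ∧ SAtom.rel r z w ∈ Γ) ∨
  (∃ z w, eqRel Γ y z ∧ eqRel Γ x w ∧ SAtom.rel r.invert z w ∈ Γ)

/-- Propagation paths: PG(Γ) ⊨ [x]_Γ ⟶^S [y]_Γ for a string S of roles. -/
def pgPath (Γ : Set SAtom) : List Role → ℕ → ℕ → Prop
  | [], x, y => eqRel Γ x y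
  | r :: S, x, y => ∃ z, pgEdge Γ x r z ∧ pgPath Γ S z y

/-- PG(Γ) ⊨ [x]_Γ ⟶^L [y]_Γ with L = L_{G(O)}(r). -/
def pgLang (Γ : Set SAtom) (O : Ontology) (r : Role) (x y : ℕ) : Prop :=
  ∃ S ∈ lang O r, pgPath Γ S x y

/-- The edge relation of the directed graph determined by the role atoms of Γ. -/
def edgeRel (Γ : Set SAtom) (x y : ℕ) : Prop := ∃ r, SAtom.rel r x y ∈ Γ

/-- Γ forms a (directed) tree. -/
def FormsTree (Γ : Finset SAtom) : Prop :=
  Γ = ∅ ∨ ∃ root ∈ labSetF Γ,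
    (∀ x ∈ labSetF Γ, Relation.ReflTransGen (edgeRel ↑Γ) root x) ∧
    (∀ y, ¬ edgeRel ↑Γ y root) ∧
    (∀ x y y', edgeRel ↑Γ y x → edgeRel ↑Γ y' x → y = y')

/-- Γ ⊢ Δ is a sequent. -/
def IsSequent (Γ : Finset SAtom) (Δ : Multiset LC) : Prop :=
  FormsTree Γ ∧
  (Γ ≠ ∅ → ∀ p ∈ Δ, p.1 ∈ labSetF Γ) ∧
  (Γ = ∅ → ∃ x, Δlabels Δ = {x})

/-- y : O̅, the multiset of labeled concepts y : ¬̇C for the GCIs ⊤ ⊑ C of O. -/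
def obar (O : Ontology) (y : ℕ) : Multiset LC := O.gcis.val.map (fun C => (y, nnfNeg C))

/-- x : O̅ for every label x in a given finite set of labels. -/
def obarFor (O : Ontology) (ls : Finset ℕ) : Multiset LC := ls.val.bind (obar O)

/-- y is fresh, i.e. does not occur in the sequent Γ ⊢ Δ. -/
def FreshLabel (y : ℕ) (Γ : Finset SAtom) (Δ : Multiset LC) : Prop :=
  y ∉ labSetF Γ ∧ ∀ p ∈ Δ, p.1 ≠ y

/-- The set {yᵢ ≠̇ yⱼ | i < j}. -/
def neqSet {n : ℕ} (ys : Fin n → ℕ) : Finset SAtom :=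
  ((Finset.univ : Finset (Fin n × Fin n)).filter (fun p => p.1 < p.2)).image
    (fun p => SAtom.neq (ys p.1) (ys p.2))

/-- The set {r(x, yᵢ) | i}. -/
def relSet {n : ℕ} (r : Role) (x : ℕ) (ys : Fin n → ℕ) : Finset SAtom :=
  (Finset.univ : Finset (Fin n)).image (fun i => SAtom.rel r x (ys i))

/-- The multiset y₀ : ¬̇C, y₀ : O̅, …, yₙ : ¬̇C, yₙ : O̅. -/
def leΔ (O : Ontology) (C : Concept) {n : ℕ} (ys : Fin n → ℕ) : Multiset LC :=
  ∑ i : Fin n, ((ys i, nnfNeg C) ::ₘ obar O (ys i))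

/-- The sequent calculus S(O): `Deriv O Γ Δ n` states that the sequent Γ ⊢ Δ has
a proof in S(O) of height at most n. -/
inductive Deriv (O : Ontology) : Finset SAtom → Multiset LC → ℕ → Prop
  | id (Γ : Finset SAtom) (Δ : Multiset LC) (x A : ℕ) (n : ℕ) :
      Deriv O Γ ((x, Concept.atom A) ::ₘ (x, Concept.nneg A) ::ₘ Δ) n
  | idEq (Γ : Finset SAtom) (Δ : Multiset LC) (x y : ℕ) (n : ℕ)
      (hmem : SAtom.neq x y ∈ Γ) (h : eqRel ↑Γ x y) :
      Deriv O Γ Δ n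
  | subst (Γ : Finset SAtom) (Δ : Multiset LC) (x y : ℕ) (L : Concept) (n : ℕ)
      (hL : IsLiteral L) (h : eqRel ↑Γ x y)
      (p : Deriv O Γ ((x, L) ::ₘ (y, L) ::ₘ Δ) n) :
      Deriv O Γ ((x, L) ::ₘ Δ) (n + 1)
  | orR (Γ : Finset SAtom) (Δ : Multiset LC) (x : ℕ) (C D : Concept) (n : ℕ)
      (p : Deriv O Γ ((x, C) ::ₘ (x, D) ::ₘ Δ) n) :
      Deriv O Γ ((x, Concept.union C D) ::ₘ Δ) (n + 1)
  | andR (Γ : Finset SAtom) (Δ : Multiset LC) (x : ℕ) (C D : Concept) (n : ℕ)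
      (p : Deriv O Γ ((x, C) ::ₘ Δ) n) (q : Deriv O Γ ((x, D) ::ₘ Δ) n) :
      Deriv O Γ ((x, Concept.inter C D) ::ₘ Δ) (n + 1)
  | exR (Γ : Finset SAtom) (Δ : Multiset LC) (x y : ℕ) (r : Role) (C : Concept) (n : ℕ)
      (h : pgLang ↑Γ O r x y)
      (p : Deriv O Γ ((x, Concept.ex r C) ::ₘ (y, C) ::ₘ Δ) n) :
      Deriv O Γ ((x, Concept.ex r C) ::ₘ Δ) (n + 1)
  | allR (Γ : Finset SAtom) (Δ : Multiset LC) (x y : ℕ) (r : Role) (C : Concept) (n : ℕ)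
      (hy : FreshLabel y Γ ((x, Concept.all r C) ::ₘ Δ))
      (p : Deriv O (insert (SAtom.rel r x y) Γ) ((y, C) ::ₘ (obar O y + Δ)) n) :
      Deriv O Γ ((x, Concept.all r C) ::ₘ Δ) (n + 1)
  | leR (Γ : Finset SAtom) (Δ : Multiset LC) (x : ℕ) (r : Role) (C : Concept)
      (k : ℕ) (n : ℕ) (ys : Fin (k + 1) → ℕ)
      (hinj : Function.Injective ys)
      (hfresh : ∀ i, FreshLabel (ys i) Γ ((x, Concept.atMost k r C) ::ₘ Δ))
      (p : Deriv O (Γ ∪ neqSet ys ∪ relSet r x ys) (leΔ O C ys + Δ) n) :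
      Deriv O Γ ((x, Concept.atMost k r C) ::ₘ Δ) (n + 1)
  | geR (Γ : Finset SAtom) (Δ : Multiset LC) (x : ℕ) (r : Role) (C : Concept)
      (k : ℕ) (n : ℕ) (ys : Fin k → ℕ)
      (hpath : ∀ i, pgLang ↑Γ O r x (ys i))
      (p : ∀ i, Deriv O Γ ((ys i, C) ::ₘ (x, Concept.atLeast k r C) ::ₘ Δ) n)
      (q : ∀ i j : Fin k, i < j →
        Deriv O (insert (SAtom.eq (ys i) (ys j)) Γ) ((x, Concept.atLeast k r C) ::ₘ Δ) n) :
      Deriv O Γ ((x, Concept.atLeast k r C) ::ₘ Δ) (n + 1)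

/-- S(O) ⊩ Γ ⊢ Δ. -/
def SProvable (O : Ontology) (Γ : Finset SAtom) (Δ : Multiset LC) : Prop := ∃ n, Deriv O Γ Δ n

/-- Satisfaction of a structural atom under a label assignment. -/
def satAtom {δ : Type} (I : Interp δ) (lam : ℕ → δ) : SAtom → Prop
  | .rel r x y => (lam x, lam y) ∈ I.roleI r
  | .eq x y => lam x = lam y
  | .neq x y => lam x ≠ lam y

/-- I, λ ⊨^∀ Γ. -/
def satAll {δ : Type} (I : Interp δ) (lam : ℕ → δ) (Γ : Set SAtom) : Prop :=
  ∀ a ∈ Γ, satAtom I lam a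

/-- I, λ ⊨^∃ Δ. -/
def satEx {δ : Type} (I : Interp δ) (lam : ℕ → δ) (Δ : Multiset LC) : Prop :=
  ∃ p ∈ Δ, lam p.1 ∈ I.cInterp p.2

/-- ⊨_O Γ ⊢ Δ : validity of a sequent relative to O. -/
def ValidSeq (O : Ontology) (Γ : Finset SAtom) (Δ : Multiset LC) : Prop :=
  ∀ (δ : Type) [Nonempty δ] (I : Interp δ) (lam : ℕ → δ),
    I.models O → satAll I lam ↑Γ → satEx I lam Δ

/-- Label substitution (x/y) on labels: replace y by x. -/
def substLab (x y z : ℕ) : ℕ := if z = y then x else z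

/-- Label substitution (x/y) on structural atoms. -/
def SAtom.substL (x y : ℕ) : SAtom → SAtom
  | .rel r a b => .rel r (substLab x y a) (substLab x y b)
  | .eq a b => .eq (substLab x y a) (substLab x y b)
  | .neq a b => .neq (substLab x y a) (substLab x y b)

/-- Label substitution (x/y) on the antecedent. -/
def substΓ (x y : ℕ) (Γ : Finset SAtom) : Finset SAtom := Γ.image (SAtom.substL x y)

/-- Label substitution (x/y) on the consequent. -/
def substΔ (x y : ℕ) (Δ : Multiset LC) : Multiset LC := Δ.map (fun p => (substLab x y p.1, p.2))

/-- Exactly one of three propositions holds. -/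
def XOr3 (a b c : Prop) : Prop := (a ∧ ¬b ∧ ¬c) ∨ (¬a ∧ b ∧ ¬c) ∨ (¬a ∧ ¬b ∧ c)

/-- A member Γᵢ ⊢ Δᵢ of an interpolant. -/
abbrev ISeq := (Finset SAtom) × (Finset LC)

/-- 𝒢 is an interpolant: every member's antecedent consists of equality and
inequality atoms between distinct labels. -/
def IsInterpolant (G : Finset ISeq) : Prop :=
  ∀ p ∈ G, ∀ a ∈ p.1, ∃ x y : ℕ, x ≠ y ∧ (a = SAtom.eq x y ∨ a = SAtom.neq x y)

/-- The orthogonality condition between a member p of 𝒢 and a candidate q. -/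
def orthCond (p q : ISeq) : Prop :=
  XOr3 (∃ x y, SAtom.eq x y ∈ q.1 ∧ SAtom.neq x y ∈ p.1)
       (∃ x y, SAtom.neq x y ∈ q.1 ∧ SAtom.eq x y ∈ p.1)
       (∃ x C, (x, nnfNeg C) ∈ q.2 ∧ (x, C) ∈ p.2)

/-- The orthogonal 𝒢^⊥. -/
def OrthP (G : Set ISeq) : Set ISeq := {q | ∀ p ∈ G, orthCond p q}

/-- Labels occurring in a member of an interpolant. -/
def iseqLabels (p : ISeq) : Finset ℕ := labSetF p.1 ∪ p.2.image Prod.fst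

/-- Concept names occurring in a multiset of labeled concepts. -/
def ΔcnamesS (Δ : Multiset LC) : Set ℕ := {A | ∃ p ∈ Δ, A ∈ cnames p.2}

/-- Disjunction of a list of concepts. -/
def bigUnionL : List Concept → Concept
  | [] => botC
  | [C] => C
  | C :: D :: L => .union C (bigUnionL (D :: L))

/-- Conjunction of a list of concepts. -/
def bigInterL : List Concept → Concept
  | [] => topC
  | [C] => C
  | C :: D :: L => .inter C (bigInterL (D :: L))

/-- ⊓⊔𝒢 : the conjunction of the disjunctions of the members of 𝒢. -/
def interUnion (G : List (List Concept)) : Concept := bigInterL (G.map bigUnionL)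

/-- The interpolant {(⊢ x : C_{i,1}, …, x : C_{i,k_i}) | 1 ≤ i ≤ n}, as a set of ISeqs. -/
def simpleG (x : ℕ) (G : List (List Concept)) : Set ISeq :=
  {p | ∃ S ∈ G, p = (∅, (S.map (fun C => (x, C))).toFinset)}

/-- Renaming of concept names in a concept. -/
def renameC (ρ : ℕ → ℕ) : Concept → Concept
  | .atom A => .atom (ρ A)
  | .nneg A => .nneg (ρ A)
  | .inter C D => .inter (renameC ρ C) (renameC ρ D)
  | .union C D => .union (renameC ρ C) (renameC ρ D)
  | .ex r C => .ex r (renameC ρ C)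
  | .all r C => .all r (renameC ρ C)
  | .atMost n r C => .atMost n r (renameC ρ C)
  | .atLeast n r C => .atLeast n r (renameC ρ C)

/-- Renaming of concept names in an ontology. -/
def renameO (ρ : ℕ → ℕ) (O : Ontology) : Ontology := ⟨O.rias, O.gcis.image (renameC ρ)⟩

/-- C is implicitly concept-definable from Θ under O. -/
def ImplicitlyDefinable (C : Concept) (O : Ontology) (Θ : Finset ℕ) : Prop :=
  ∀ (δ : Type) [Nonempty δ] (I J : Interp δ), I.models O → J.models O →
    (∀ r, I.rI r = J.rI r) → (∀ A ∈ Θ, I.cI A = J.cI A) →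
    I.cInterp C = J.cInterp C

/-- C is explicitly concept-definable from Θ under O. -/
def ExplicitlyDefinable (C : Concept) (O : Ontology) (Θ : Finset ℕ) : Prop :=
  ∃ D : Concept, cnames D ⊆ Θ ∧ entails O C D ∧ entails O D C

/-- RIQ has the concept interpolation property. -/
def ConceptInterpolationProperty : Prop :=
  ∀ (O₁ O₂ : Ontology) (C D : Concept), entails (O₁.union O₂) C D →
    ∃ I : Concept, cnames I ⊆ (cnames C ∪ O₁.cnames) ∩ (cnames D ∪ O₂.cnames) ∧
      entails (O₁.union O₂) C I ∧ entails (O₁.union O₂) I D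

/-- RIQ has the concept-based Beth definability property. -/
def CBP : Prop :=
  ∀ (C : Concept) (O : Ontology) (Θ : Finset ℕ), Θ ⊆ cnames C ∪ O.cnames →
    ImplicitlyDefinable C O Θ → ExplicitlyDefinable C O Θ


/-- Renaming of the labels of a structural atom. -/
def SAtom.map (f : ℕ → ℕ) : SAtom → SAtom
  | .rel r a b => .rel r (f a) (f b)
  | .eq a b => .eq (f a) (f b)
  | .neq a b => .neq (f a) (f b)

/-- Renaming of the label of a labeled concept. -/
def LC.map (f : ℕ → ℕ) (p : LC) : LC := (f p.1, p.2)

theorem SAtom.map_congr {f g : ℕ → ℕ} {a : SAtom} (h : ∀ x ∈ a.labels, f x = g x) :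
    a.map f = a.map g := by
  cases a <;> simp_all [SAtom.map, SAtom.labels]

theorem SAtom.map_id (a : SAtom) : a.map id = a := by
  cases a <;> rfl

theorem mem_labSetF {Γ : Finset SAtom} {a : SAtom} {x : ℕ} (ha : a ∈ Γ) (hx : x ∈ a.labels) :
    x ∈ labSetF Γ :=
  Finset.mem_biUnion.2 ⟨a, ha, hx⟩

section Renaming

variable {Γ Γ' : Set SAtom} {f : ℕ → ℕ}

theorem eqRel.map (hΓ : ∀ a ∈ Γ, a.map f ∈ Γ') {x y : ℕ} (h : eqRel Γ x y) :
    eqRel Γ' (f x) (f y) :=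
  Relation.ReflTransGen.lift f (fun _ _ h => h.imp (hΓ _) (hΓ _)) _ _ h

theorem pgEdge.map (hΓ : ∀ a ∈ Γ, a.map f ∈ Γ') {x y : ℕ} {r : Role} (h : pgEdge Γ x r y) :
    pgEdge Γ' (f x) r (f y) := by
  rcases h with ⟨z, w, hz, hw, hr⟩ | ⟨z, w, hz, hw, hr⟩
  · exact .inl ⟨f z, f w, hz.map hΓ, hw.map hΓ, hΓ _ hr⟩
  · exact .inr ⟨f z, f w, hz.map hΓ, hw.map hΓ, hΓ _ hr⟩

theorem pgPath.map (hΓ : ∀ a ∈ Γ, a.map f ∈ Γ') {S : List Role} {x y : ℕ}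
    (h : pgPath Γ S x y) : pgPath Γ' S (f x) (f y) := by
  induction S generalizing x with
  | nil => exact eqRel.map hΓ h
  | cons r S ih =>
    obtain ⟨z, hz, h⟩ := h
    exact ⟨f z, hz.map hΓ, ih h⟩

theorem pgLang.map (hΓ : ∀ a ∈ Γ, a.map f ∈ Γ') {O : Ontology} {r : Role} {x y : ℕ}
    (h : pgLang Γ O r x y) : pgLang Γ' O r (f x) (f y) := by
  obtain ⟨S, hS, h⟩ := h
  exact ⟨S, hS, h.map hΓ⟩

end Renaming

theorem pgLang.mono {Γ Γ' : Finset SAtom} (hΓ : Γ ⊆ Γ') {O : Ontology} {r : Role} {x y : ℕ}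
    (h : pgLang ↑Γ O r x y) : pgLang ↑Γ' O r x y :=
  h.map (f := id) fun a ha => by rw [a.map_id]; exact hΓ ha

theorem eqRel.mono {Γ Γ' : Finset SAtom} (hΓ : Γ ⊆ Γ') {x y : ℕ}
    (h : eqRel ↑Γ x y) : eqRel ↑Γ' x y :=
  h.map (f := id) fun a ha => by rw [a.map_id]; exact hΓ ha

theorem map_congr_labels {Δ : Multiset LC} {f g : ℕ → ℕ} (h : ∀ p ∈ Δ, g p.1 = f p.1) :
    Δ.map (LC.map g) = Δ.map (LC.map f) :=
  Multiset.map_congr rfl fun p hp => by simp [LC.map, h p hp]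

theorem map_id_labels (Δ : Multiset LC) : Δ.map (LC.map _root_.id) = Δ :=
  Multiset.map_id Δ

theorem map_obar (O : Ontology) (f : ℕ → ℕ) (y : ℕ) :
    (obar O y).map (LC.map f) = obar O (f y) := by
  simp only [obar, Multiset.map_map]
  rfl

theorem map_leΔ (O : Ontology) (C : Concept) (f : ℕ → ℕ) {n : ℕ} (ys : Fin n → ℕ) :
    (leΔ O C ys).map (LC.map f) = leΔ O C (f ∘ ys) := by
  have := map_sum (Multiset.mapAddMonoidHom (LC.map f))
    (fun i => (ys i, nnfNeg C) ::ₘ obar O (ys i)) Finset.univ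
  simp only [Multiset.coe_mapAddMonoidHom] at this
  simp [leΔ, this, map_obar, LC.map]

theorem map_mem_neqSet {n : ℕ} {ys : Fin n → ℕ} (f : ℕ → ℕ) {a : SAtom} (ha : a ∈ neqSet ys) :
    a.map f ∈ neqSet (f ∘ ys) := by
  simp only [neqSet, Finset.mem_image] at ha ⊢
  obtain ⟨p, hp, rfl⟩ := ha
  exact ⟨p, hp, rfl⟩

theorem map_mem_relSet {n : ℕ} {ys : Fin n → ℕ} {r : Role} {x : ℕ} (f : ℕ → ℕ) {a : SAtom}
    (ha : a ∈ relSet r x ys) : a.map f ∈ relSet r (f x) (f ∘ ys) := by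
  simp only [relSet, Finset.mem_image] at ha ⊢
  obtain ⟨i, hi, rfl⟩ := ha
  exact ⟨i, hi, rfl⟩

theorem exists_freshLabels (k : ℕ) (Γ : Finset SAtom) (Δ : Multiset LC) :
    ∃ ys : Fin k → ℕ, Function.Injective ys ∧ ∀ i, FreshLabel (ys i) Γ Δ := by
  obtain ⟨b, hb⟩ := (labSetF Γ ∪ Δlabels Δ).bddAbove
  refine ⟨fun i => b + 1 + i, fun i j h => Fin.ext (by simpa using h), fun i => ⟨fun h => ?_, ?_⟩⟩
  · have : b + 1 + i ≤ b := hb (Finset.mem_union_left _ h)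
    omega
  · rintro p hp h
    have : p.1 ∈ Δlabels Δ := by
      simpa [Δlabels] using ⟨p.2, hp⟩
    have : b + 1 + i ≤ b := h.symm.trans_le (hb (Finset.mem_union_right _ this))
    omega

theorem exists_freshLabel (Γ : Finset SAtom) (Δ : Multiset LC) : ∃ y, FreshLabel y Γ Δ :=
  let ⟨ys, _, h⟩ := exists_freshLabels 1 Γ Δ
  ⟨ys 0, h 0⟩

/-- A renaming can be redirected at fresh labels without affecting how it acts on a sequent. -/
theorem FreshLabel.exists_redirect {n : ℕ} {Γ : Finset SAtom} {Δ : Multiset LC}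
    {ys : Fin n → ℕ} (hinj : Function.Injective ys) (hfresh : ∀ i, FreshLabel (ys i) Γ Δ)
    (f : ℕ → ℕ) (zs : Fin n → ℕ) :
    ∃ g : ℕ → ℕ, g ∘ ys = zs ∧ (∀ a ∈ Γ, a.map g = a.map f) ∧ ∀ p ∈ Δ, g p.1 = f p.1 := by
  have hg (x : ℕ) (h : ∀ i, ys i ≠ x) : Function.extend ys zs f x = f x :=
    Function.extend_apply' _ _ _ fun ⟨i, hi⟩ => h i hi
  refine ⟨Function.extend ys zs f, Function.extend_comp hinj _ _,
    fun a ha => SAtom.map_congr fun x hx => hg x ?_, fun p hp => hg _ ?_⟩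
  · rintro i rfl
    exact (hfresh i).1 (mem_labSetF ha hx)
  · exact fun i h => (hfresh i).2 p hp h.symm

theorem exists_eq_cons_of_cons_le {α : Type*} {a : α} {s t : Multiset α}
    (h : a ::ₘ s ≤ t) : ∃ u, t = a ::ₘ u ∧ s ≤ u := by
  obtain ⟨v, rfl⟩ := Multiset.le_iff_exists_add.1 h
  exact ⟨s + v, by simp, by simp⟩

namespace Deriv

variable {O : Ontology} {Γ : Finset SAtom} {Δ : Multiset LC} {n : ℕ}

theorem succ (d : Deriv O Γ Δ n) : Deriv O Γ Δ (n + 1) := by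
  induction d with
  | id => exact .id ..
  | idEq _ _ _ _ _ hmem h => exact .idEq _ _ _ _ _ hmem h
  | subst _ _ _ _ _ _ hL h _ ih => exact .subst _ _ _ _ _ _ hL h ih
  | orR _ _ _ _ _ _ _ ih => exact .orR _ _ _ _ _ _ ih
  | andR _ _ _ _ _ _ _ _ ih₁ ih₂ => exact .andR _ _ _ _ _ _ ih₁ ih₂
  | exR _ _ _ _ _ _ _ h _ ih => exact .exR _ _ _ _ _ _ _ h ih
  | allR _ _ _ _ _ _ _ hy _ ih => exact .allR _ _ _ _ _ _ _ hy ih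
  | leR _ _ _ _ _ _ _ _ hinj hf _ ih => exact .leR _ _ _ _ _ _ _ _ hinj hf ih
  | geR _ _ _ _ _ _ _ _ hpath _ _ ih₁ ih₂ => exact .geR _ _ _ _ _ _ _ _ hpath ih₁ ih₂

/-- Height-preserving admissibility of label substitution and weakening. -/
theorem map_weaken (d : Deriv O Γ Δ n) (f : ℕ → ℕ) {Γ' : Finset SAtom} {Δ' : Multiset LC}
    (hΓ : ∀ a ∈ Γ, a.map f ∈ Γ') (hΔ : Δ.map (LC.map f) ≤ Δ') : Deriv O Γ' Δ' n := by
  induction d generalizing f Γ' Δ' with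
  | id Γ Δ x A n =>
    simp only [Multiset.map_cons] at hΔ
    obtain ⟨E, rfl, hE⟩ := exists_eq_cons_of_cons_le hΔ
    obtain ⟨E, rfl, -⟩ := exists_eq_cons_of_cons_le hE
    exact .id ..
  | idEq Γ Δ x y n hmem h => exact .idEq _ _ _ _ _ (hΓ _ hmem) (h.map hΓ)
  | subst Γ Δ x y L n hL h p ih =>
    simp only [Multiset.map_cons] at hΔ ih
    obtain ⟨E, rfl, hE⟩ := exists_eq_cons_of_cons_le hΔ
    exact .subst _ _ _ (f y) _ _ hL (h.map hΓ)
      (ih f hΓ (Multiset.cons_le_cons _ (Multiset.cons_le_cons _ hE)))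
  | orR Γ Δ x C D n p ih =>
    simp only [Multiset.map_cons] at hΔ ih
    obtain ⟨E, rfl, hE⟩ := exists_eq_cons_of_cons_le hΔ
    exact .orR _ _ _ _ _ _ (ih f hΓ (Multiset.cons_le_cons _ (Multiset.cons_le_cons _ hE)))
  | andR Γ Δ x C D n p q ih₁ ih₂ =>
    simp only [Multiset.map_cons] at hΔ ih₁ ih₂
    obtain ⟨E, rfl, hE⟩ := exists_eq_cons_of_cons_le hΔ
    exact .andR _ _ _ _ _ _ (ih₁ f hΓ (Multiset.cons_le_cons _ hE))
      (ih₂ f hΓ (Multiset.cons_le_cons _ hE))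
  | exR Γ Δ x y r C n h p ih =>
    simp only [Multiset.map_cons] at hΔ ih
    obtain ⟨E, rfl, hE⟩ := exists_eq_cons_of_cons_le hΔ
    exact .exR _ _ _ (f y) _ _ _ (h.map hΓ)
      (ih f hΓ (Multiset.cons_le_cons _ (Multiset.cons_le_cons _ hE)))
  | allR Γ Δ x y r C n hy p ih =>
    obtain ⟨z, hz⟩ := exists_freshLabel Γ' Δ'
    obtain ⟨g, hgy, hgΓ, hgΔ⟩ := FreshLabel.exists_redirect (ys := fun _ : Fin 1 => y)
      (Function.injective_of_subsingleton _) (fun _ => hy) f (fun _ => z)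
    replace hgy : g y = z := congrFun hgy 0
    have hx : g x = f x := hgΔ _ (Multiset.mem_cons_self _ _)
    rw [← map_congr_labels hgΔ, Multiset.map_cons] at hΔ
    obtain ⟨E, rfl, hE⟩ := exists_eq_cons_of_cons_le hΔ
    simp only [LC.map, hx] at hz ⊢
    refine .allR _ _ _ z _ _ _ hz (ih g (fun a ha => ?_) ?_)
    · rcases Finset.mem_insert.1 ha with rfl | ha
      · simp [SAtom.map, hgy, hx]
      · rw [hgΓ a ha]
        exact Finset.mem_insert_of_mem (hΓ a ha)
    · simpa [map_obar, hgy, LC.map] using hE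
  | leR Γ Δ x r C k n ys hinj hfresh p ih =>
    obtain ⟨zs, hzinj, hz⟩ := exists_freshLabels (k + 1) Γ' Δ'
    obtain ⟨g, hgy, hgΓ, hgΔ⟩ := FreshLabel.exists_redirect hinj hfresh f zs
    have hx : g x = f x := hgΔ _ (Multiset.mem_cons_self _ _)
    rw [← map_congr_labels hgΔ, Multiset.map_cons] at hΔ
    obtain ⟨E, rfl, hE⟩ := exists_eq_cons_of_cons_le hΔ
    simp only [LC.map, hx] at hz ⊢
    refine .leR _ _ _ _ _ _ _ zs hzinj hz (ih g (fun a ha => ?_) ?_)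
    · rw [← hgy]
      simp only [Finset.mem_union] at ha ⊢
      rcases ha with (ha | ha) | ha
      · rw [hgΓ a ha]
        exact .inl (.inl (hΓ a ha))
      · exact .inl (.inr (map_mem_neqSet g ha))
      · exact .inr (hx ▸ map_mem_relSet g ha)
    · simpa [map_leΔ, hgy] using hE
  | geR Γ Δ x r C k n ys hpath p q ih₁ ih₂ =>
    simp only [Multiset.map_cons] at hΔ ih₁ ih₂
    obtain ⟨E, rfl, hE⟩ := exists_eq_cons_of_cons_le hΔ
    refine .geR _ _ _ _ _ _ _ (f ∘ ys) (fun i => (hpath i).map hΓ)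
      (fun i => ih₁ i f hΓ (Multiset.cons_le_cons _ (Multiset.cons_le_cons _ hE)))
      (fun i j hij => ih₂ i j hij f (fun a ha => ?_) (Multiset.cons_le_cons _ hE))
    rcases Finset.mem_insert.1 ha with rfl | ha
    · exact Finset.mem_insert_self _ _
    · exact Finset.mem_insert_of_mem (hΓ a ha)

theorem weaken (d : Deriv O Γ Δ n) {Γ' : Finset SAtom} {Δ' : Multiset LC}
    (hΓ : Γ ⊆ Γ') (hΔ : Δ ≤ Δ') : Deriv O Γ' Δ' n :=
  d.map_weaken _root_.id (fun a ha => by rw [a.map_id]; exact hΓ ha) (by rwa [map_id_labels])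

/-- The eigenvariable of (∀r) can be replaced by an arbitrary label. -/
theorem rename_all {x y : ℕ} {r : Role} {C : Concept}
    (hy : FreshLabel y Γ ((x, Concept.all r C) ::ₘ Δ))
    (d : Deriv O (insert (SAtom.rel r x y) Γ) ((y, C) ::ₘ (obar O y + Δ)) n) (z : ℕ) :
    Deriv O (insert (SAtom.rel r x z) Γ) ((z, C) ::ₘ (obar O z + Δ)) n := by
  obtain ⟨g, hgy, hgΓ, hgΔ⟩ := FreshLabel.exists_redirect (ys := fun _ : Fin 1 => y)
    (Function.injective_of_subsingleton _) (fun _ => hy) _root_.id (fun _ => z)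
  replace hgy : g y = z := congrFun hgy 0
  have hx : g x = x := hgΔ _ (Multiset.mem_cons_self _ _)
  refine d.map_weaken g (fun a ha => ?_) ?_
  · rcases Finset.mem_insert.1 ha with rfl | ha
    · simp [SAtom.map, hgy, hx]
    · rw [hgΓ a ha, a.map_id]
      exact Finset.mem_insert_of_mem ha
  · rw [Multiset.map_cons, Multiset.map_add,
      map_congr_labels fun p hp => hgΔ p (Multiset.mem_cons_of_mem hp)]
    simp [map_obar, hgy, LC.map, map_id_labels]

/-- The eigenvariables of (≤n r) can be replaced by arbitrary labels. -/
theorem rename_atMost {x : ℕ} {r : Role} {C : Concept} {k : ℕ} {ys : Fin (k + 1) → ℕ}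
    (hinj : Function.Injective ys)
    (hfresh : ∀ i, FreshLabel (ys i) Γ ((x, Concept.atMost k r C) ::ₘ Δ))
    (d : Deriv O (Γ ∪ neqSet ys ∪ relSet r x ys) (leΔ O C ys + Δ) n) (zs : Fin (k + 1) → ℕ) :
    Deriv O (Γ ∪ neqSet zs ∪ relSet r x zs) (leΔ O C zs + Δ) n := by
  obtain ⟨g, rfl, hgΓ, hgΔ⟩ := FreshLabel.exists_redirect hinj hfresh _root_.id zs
  have hx : g x = x := hgΔ _ (Multiset.mem_cons_self _ _)
  refine d.map_weaken g (fun a ha => ?_) ?_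
  · simp only [Finset.mem_union] at ha ⊢
    rcases ha with (ha | ha) | ha
    · rw [hgΓ a ha, a.map_id]
      exact .inl (.inl ha)
    · exact .inl (.inr (map_mem_neqSet g ha))
    · have := map_mem_relSet g ha
      rw [hx] at this
      exact .inr this
  · rw [Multiset.map_add, map_leΔ,
      map_congr_labels fun p hp => hgΔ p (Multiset.mem_cons_of_mem hp), map_id_labels]

end Deriv

/-- `Reduct O p G N`: some premise of a rule with principal formula `p`, one of (⊔), (⊓), (∀r),
(≤n r), replaces `p` by `N` and adds the structural atoms `G`. -/
inductive Reduct (O : Ontology) : LC → Finset SAtom → Multiset LC → Prop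
  | union (x : ℕ) (C D : Concept) : Reduct O (x, .union C D) ∅ {(x, C), (x, D)}
  | interLeft (x : ℕ) (C D : Concept) : Reduct O (x, .inter C D) ∅ {(x, C)}
  | interRight (x : ℕ) (C D : Concept) : Reduct O (x, .inter C D) ∅ {(x, D)}
  | all (x y : ℕ) (r : Role) (C : Concept) :
      Reduct O (x, .all r C) {SAtom.rel r x y} ((y, C) ::ₘ obar O y)
  | atMost (x : ℕ) (k : ℕ) (r : Role) (C : Concept) (ys : Fin (k + 1) → ℕ) :
      Reduct O (x, .atMost k r C) (neqSet ys ∪ relSet r x ys) (leΔ O C ys)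

theorem Reduct.not_isLiteral {O : Ontology} {p : LC} {G : Finset SAtom} {N : Multiset LC}
    (h : Reduct O p G N) : ¬ IsLiteral p.2 := by
  cases h <;> exact fun h => h

theorem exists_of_cons_eq_cons {α : Type*} {a b : α} {s t : Multiset α}
    (h : a ::ₘ s = b ::ₘ t) (hab : a ≠ b) : ∃ u, s = b ::ₘ u ∧ t = a ::ₘ u := by
  rcases Multiset.cons_eq_cons.1 h with ⟨h, -⟩ | ⟨-, h⟩
  · exact absurd h hab
  · exact h

/-- Height-preserving inversion of (⊔), (⊓), (∀r) and (≤n r). -/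
theorem Deriv.invert {O : Ontology} {p : LC} {G : Finset SAtom} {N : Multiset LC}
    (hp : Reduct O p G N) {Γ : Finset SAtom} {Δ S T : Multiset LC} {n : ℕ}
    (d : Deriv O Γ S n) (hS : S = p ::ₘ Δ) (hT : N + Δ = T) : Deriv O (Γ ∪ G) T n := by
  have hΓ {Γ : Finset SAtom} : Γ ⊆ Γ ∪ G := Finset.subset_union_left
  induction n generalizing Γ Δ S T with
  | zero =>
    subst hT
    cases d with
    | id Γ E x A =>
      obtain ⟨u, rfl, hu⟩ := exists_of_cons_eq_cons hS.symm
        (by rintro rfl; exact hp.not_isLiteral trivial)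
      obtain ⟨v, rfl, rfl⟩ := exists_of_cons_eq_cons hu.symm
        (by rintro rfl; exact hp.not_isLiteral trivial)
      simp only [Multiset.add_cons]
      exact .id ..
    | idEq _ _ x y _ hmem h => exact .idEq _ _ _ _ _ (hΓ hmem) (h.mono hΓ)
  | succ n ih =>
    subst hT
    cases d with
    | id Γ E x A =>
      obtain ⟨u, rfl, hu⟩ := exists_of_cons_eq_cons hS.symm
        (by rintro rfl; exact hp.not_isLiteral trivial)
      obtain ⟨v, rfl, rfl⟩ := exists_of_cons_eq_cons hu.symm
        (by rintro rfl; exact hp.not_isLiteral trivial)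
      simp only [Multiset.add_cons]
      exact .id ..
    | idEq _ _ x y _ hmem h => exact .idEq _ _ _ _ _ (hΓ hmem) (h.mono hΓ)
    | subst _ E x y L _ hL h d =>
      obtain ⟨u, rfl, rfl⟩ := exists_of_cons_eq_cons hS.symm
        (by rintro rfl; exact hp.not_isLiteral hL)
      rw [Multiset.add_cons]
      exact .subst _ _ _ _ _ _ hL (h.mono hΓ)
        (ih (Δ := (x, L) ::ₘ (y, L) ::ₘ u) d
          (by simp only [← Multiset.singleton_add]; abel) (by simp))
    | orR _ E x C D _ d =>
      rcases Multiset.cons_eq_cons.1 hS with ⟨rfl, rfl⟩ | ⟨-, u, rfl, rfl⟩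
      · cases hp
        simpa using d.succ
      · rw [Multiset.add_cons]
        exact .orR _ _ _ _ _ _ (ih (Δ := (x, C) ::ₘ (x, D) ::ₘ u) d
          (by simp only [← Multiset.singleton_add]; abel) (by simp))
    | andR _ E x C D _ d₁ d₂ =>
      rcases Multiset.cons_eq_cons.1 hS with ⟨rfl, rfl⟩ | ⟨-, u, rfl, rfl⟩
      · cases hp
        · simpa using d₁.succ
        · simpa using d₂.succ
      · rw [Multiset.add_cons]
        exact .andR _ _ _ _ _ _
          (ih (Δ := (x, C) ::ₘ u) d₁ (Multiset.cons_swap ..) (by simp))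
          (ih (Δ := (x, D) ::ₘ u) d₂ (Multiset.cons_swap ..) (by simp))
    | exR _ E x y r C _ h d =>
      rcases Multiset.cons_eq_cons.1 hS with ⟨rfl, rfl⟩ | ⟨-, u, rfl, rfl⟩
      · cases hp
      · rw [Multiset.add_cons]
        exact .exR _ _ _ y _ _ _ (h.mono hΓ) (ih (Δ := (x, .ex r C) ::ₘ (y, C) ::ₘ u) d
          (by simp only [← Multiset.singleton_add]; abel) (by simp))
    | allR _ E x y r C _ hy d =>
      replace d := d.rename_all hy
      rcases Multiset.cons_eq_cons.1 hS with ⟨rfl, rfl⟩ | ⟨-, u, rfl, rfl⟩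
      · cases hp with
        | all _ z =>
          simpa [Finset.union_singleton] using (d z).succ
      · rw [Multiset.add_cons]
        obtain ⟨z, hz⟩ := exists_freshLabel (Γ ∪ G) ((x, .all r C) ::ₘ (N + u))
        refine .allR _ _ _ z _ _ _ hz ?_
        rw [← Finset.insert_union]
        exact ih (Δ := (z, C) ::ₘ (obar O z + u)) (d z)
          (by simp only [← Multiset.singleton_add]; abel)
          (by simp only [← Multiset.singleton_add]; abel)
    | leR _ E x r C k _ ys hinj hfresh d =>
      replace d := d.rename_atMost hinj hfresh
      rcases Multiset.cons_eq_cons.1 hS with ⟨rfl, rfl⟩ | ⟨-, u, rfl, rfl⟩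
      · cases hp with
        | atMost _ _ _ _ zs =>
          simpa using (d zs).succ
      · rw [Multiset.add_cons]
        obtain ⟨zs, hzinj, hz⟩ :=
          exists_freshLabels (k + 1) (Γ ∪ G) ((x, .atMost k r C) ::ₘ (N + u))
        refine .leR _ _ _ _ _ _ _ zs hzinj hz ?_
        rw [show Γ ∪ G ∪ neqSet zs ∪ relSet r x zs = Γ ∪ neqSet zs ∪ relSet r x zs ∪ G by
          simp only [Finset.union_comm, Finset.union_left_comm]]
        exact ih (Δ := leΔ O C zs + u) (d zs)
          (by simp only [← Multiset.singleton_add]; abel) (by abel)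
    | geR _ E x r C k _ ys hpath d₁ d₂ =>
      rcases Multiset.cons_eq_cons.1 hS with ⟨rfl, rfl⟩ | ⟨-, u, rfl, rfl⟩
      · cases hp
      · rw [Multiset.add_cons]
        refine .geR _ _ _ _ _ _ _ ys (fun i => (hpath i).mono hΓ) (fun i => ?_) fun i j hij => ?_
        · exact ih (Δ := (ys i, C) ::ₘ (x, .atLeast k r C) ::ₘ u) (d₁ i)
            (by simp only [← Multiset.singleton_add]; abel) (by simp)
        · rw [← Finset.insert_union]
          exact ih (Δ := (x, .atLeast k r C) ::ₘ u) (d₂ i j hij)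
            (Multiset.cons_swap ..) (by simp)

/-- All non-initial rules of S(O) — (s≐), (⊔), (⊓), (∃r), (∀r),
(≤n r), (≥n r) — are hp-invertible. -/
theorem noninitial_rules_hp_invertible (O : Ontology) :
    (∀ (Γ : Finset SAtom) (Δ : Multiset LC) (x y : ℕ) (L : Concept) (h : ℕ),
      IsLiteral L → eqRel ↑Γ x y →
      Deriv O Γ ((x, L) ::ₘ Δ) h → Deriv O Γ ((x, L) ::ₘ (y, L) ::ₘ Δ) h) ∧
    (∀ (Γ : Finset SAtom) (Δ : Multiset LC) (x : ℕ) (C D : Concept) (h : ℕ),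
      Deriv O Γ ((x, Concept.union C D) ::ₘ Δ) h →
      Deriv O Γ ((x, C) ::ₘ (x, D) ::ₘ Δ) h) ∧
    (∀ (Γ : Finset SAtom) (Δ : Multiset LC) (x : ℕ) (C D : Concept) (h : ℕ),
      Deriv O Γ ((x, Concept.inter C D) ::ₘ Δ) h →
      Deriv O Γ ((x, C) ::ₘ Δ) h ∧ Deriv O Γ ((x, D) ::ₘ Δ) h) ∧
    (∀ (Γ : Finset SAtom) (Δ : Multiset LC) (x y : ℕ) (r : Role) (C : Concept) (h : ℕ),
      pgLang ↑Γ O r x y →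
      Deriv O Γ ((x, Concept.ex r C) ::ₘ Δ) h →
      Deriv O Γ ((x, Concept.ex r C) ::ₘ (y, C) ::ₘ Δ) h) ∧
    (∀ (Γ : Finset SAtom) (Δ : Multiset LC) (x y : ℕ) (r : Role) (C : Concept) (h : ℕ),
      FreshLabel y Γ ((x, Concept.all r C) ::ₘ Δ) →
      Deriv O Γ ((x, Concept.all r C) ::ₘ Δ) h →
      Deriv O (insert (SAtom.rel r x y) Γ) ((y, C) ::ₘ (obar O y + Δ)) h) ∧
    (∀ (Γ : Finset SAtom) (Δ : Multiset LC) (x : ℕ) (r : Role) (C : Concept)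
        (k : ℕ) (h : ℕ) (ys : Fin (k + 1) → ℕ),
      Function.Injective ys →
      (∀ i, FreshLabel (ys i) Γ ((x, Concept.atMost k r C) ::ₘ Δ)) →
      Deriv O Γ ((x, Concept.atMost k r C) ::ₘ Δ) h →
      Deriv O (Γ ∪ neqSet ys ∪ relSet r x ys) (leΔ O C ys + Δ) h) ∧
    (∀ (Γ : Finset SAtom) (Δ : Multiset LC) (x : ℕ) (r : Role) (C : Concept)
        (k : ℕ) (h : ℕ) (ys : Fin k → ℕ),
      (∀ i, pgLang ↑Γ O r x (ys i)) →
      Deriv O Γ ((x, Concept.atLeast k r C) ::ₘ Δ) h →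
      (∀ i, Deriv O Γ ((ys i, C) ::ₘ (x, Concept.atLeast k r C) ::ₘ Δ) h) ∧
      (∀ i j : Fin k, i < j →
        Deriv O (insert (SAtom.eq (ys i) (ys j)) Γ) ((x, Concept.atLeast k r C) ::ₘ Δ) h)) := by
  refine ⟨?_, ?_, ?_, ?_, ?_, ?_, ?_⟩
  · intro Γ Δ x y L h _ _ d
    exact d.weaken subset_rfl (Multiset.cons_le_cons _ (Multiset.le_cons_self _ _))
  · intro Γ Δ x C D h d
    simpa using d.invert (.union x C D) rfl rfl
  · intro Γ Δ x C D h d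
    exact ⟨by simpa using d.invert (.interLeft x C D) rfl rfl,
      by simpa using d.invert (.interRight x C D) rfl rfl⟩
  · intro Γ Δ x y r C h _ d
    exact d.weaken subset_rfl (Multiset.cons_le_cons _ (Multiset.le_cons_self _ _))
  · intro Γ Δ x y r C h _ d
    simpa [Finset.union_singleton] using d.invert (.all x y r C) rfl rfl
  · intro Γ Δ x r C k h ys _ _ d
    simpa using d.invert (.atMost x k r C ys) rfl rfl
  · intro Γ Δ x r C k h ys _ d
    exact ⟨fun i => d.weaken subset_rfl (Multiset.le_cons_self _ _),
      fun i j _ => d.weaken (Finset.subset_insert _ _) le_rfl⟩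

end RIQ
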